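/- arXiv:1605.08752 — 5 statements merged into one kernel-verified Lean document; each statement's English description precedes it below -/
import Mathlib

section
/- If 2 ≤ p ≤ k and ℱ_1, …, ℱ_k are families such that for every p-element subset {i_1, …, i_p} of [k] the tuple (ℱ_{i_1}, …, ℱ_{i_p}) has the cross-t-star property, then (ℱ_1, …, ℱ_k) has the cross-t-star property. -/
open Finset

section Defs

variable {α : Type*} [DecidableEq α]

/-- `famStar F T` is ℱ(T) = {F ∈ ℱ : T ⊆ F}. -/
def famStar (F : Finset (Finset α)) (T : Finset α) : Finset (Finset α) :=
  F.filter (fun A => T ⊆ A)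

/-- `lstar F t` is l(ℱ,t): the maximum of |ℱ(T)| over all t-element sets T. -/
noncomputable def lstar (F : Finset (Finset α)) (t : ℕ) : ℕ :=
  sSup {n : ℕ | ∃ T : Finset α, T.card = t ∧ n = (famStar F T).card}

/-- c(r,s,t) = max{r·C(s,t), s·C(r,t)} + 1 if t ≤ min{r,s}, and 1 otherwise. -/
def cfun (r s t : ℕ) : ℕ :=
  if t ≤ min r s then max (r * Nat.choose s t) (s * Nat.choose r t) + 1 else 1

/-- The tuple (𝒜_1, …, 𝒜_k) is cross-t-intersecting. -/
def CrossTuple (t : ℕ) {k : ℕ} (A : Fin k → Finset (Finset α)) : Prop :=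
  ∀ i j : Fin k, i ≠ j → ∀ a ∈ A i, ∀ b ∈ A j, t ≤ (a ∩ b).card

/-- The cross-t-star property. -/
def CrossTStar (t : ℕ) {k : ℕ} (F : Fin k → Finset (Finset α)) : Prop :=
  ∀ A : Fin k → Finset (Finset α), CrossTuple t A → (∀ i, A i ⊆ F i) →
    ∏ i, (A i).card ≤ ∏ i, lstar (F i) t

/-- The strict cross-t-star property. -/
def StrictCrossTStar (t : ℕ) {k : ℕ} (F : Fin k → Finset (Finset α)) : Prop :=
  ∀ A : Fin k → Finset (Finset α), CrossTuple t A → (∀ i, A i ⊆ F i) →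
    ∏ i, (A i).card ≤ ∏ i, lstar (F i) t ∧
      ((¬ ∃ T : Finset α, T.card = t ∧ ∀ i, A i = famStar (F i) T) →
        ∏ i, (A i).card < ∏ i, lstar (F i) t)

/-- The strong cross-t-star property. -/
def StrongCrossTStar (t : ℕ) {k : ℕ} (F : Fin k → Finset (Finset α)) : Prop :=
  ∃ T : Finset α, T.card = t ∧
    ∀ A : Fin k → Finset (Finset α), CrossTuple t A → (∀ i, A i ⊆ F i) →
      ∏ i, (A i).card ≤ ∏ i, (famStar (F i) T).card

/-- The extrastrong cross-t-star property. -/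
def ExtrastrongCrossTStar (t : ℕ) {k : ℕ} (F : Fin k → Finset (Finset α)) : Prop :=
  ∃ T : Finset α, T.card = t ∧
    ∀ A : Fin k → Finset (Finset α), CrossTuple t A → (∀ i, A i ⊆ F i) →
      ∏ i, (A i).card ≤ ∏ i, (famStar (F i) T).card ∧
        (∏ i, (A i).card = ∏ i, (famStar (F i) T).card →
          ∃ T' : Finset α, T'.card = t ∧ ∀ i, A i = famStar (F i) T')

/-- 𝒮_{X,m}: the family of subsets of X × [m] that are graphs of functions
from X to [m]; 𝒮_{∅,m} = ∅. -/
def seqFam (X : Finset α) (m : ℕ) : Finset (Finset (α × ℕ)) :=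
  (X ×ˢ Finset.Icc 1 m).powerset.filter
    (fun S => S.Nonempty ∧ S.image Prod.fst = X ∧ S.card = X.card)

/-- 𝒮_{ℱ,m} = ⋃_{F ∈ ℱ} 𝒮_{F,m}. -/
def seqFamU (F : Finset (Finset α)) (m : ℕ) : Finset (Finset (α × ℕ)) :=
  F.biUnion (fun X => seqFam X m)

/-- 𝒮*_{X,m}: the family of subsets of X × [m] that are graphs of injective
functions from X to [m]; 𝒮*_{∅,m} = ∅. -/
def seqFamInj (X : Finset α) (m : ℕ) : Finset (Finset (α × ℕ)) :=
  (seqFam X m).filter (fun S => (S.image Prod.snd).card = S.card)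

/-- 𝒮*_{ℱ,m} = ⋃_{F ∈ ℱ} 𝒮*_{F,m}. -/
def seqFamInjU (F : Finset (Finset α)) (m : ℕ) : Finset (Finset (α × ℕ)) :=
  F.biUnion (fun X => seqFamInj X m)

end Defs

open Classical in
/-- ℳ_{n,r}: representations S_A of multisets A with members in [n] of total size r:
the r-element sets S of pairs (a,j) with a ∈ [n], 1 ≤ j, such that (a,j) ∈ S and
1 ≤ j' ≤ j imply (a,j') ∈ S. -/
noncomputable def multFam (n r : ℕ) : Finset (Finset (ℕ × ℕ)) :=
  (Finset.Icc 1 n ×ˢ Finset.Icc 1 r).powerset.filter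
    (fun S => S.card = r ∧ ∀ p ∈ S, ∀ j ∈ Finset.Icc 1 p.2, (p.1, j) ∈ S)

/-- 𝒞_{n,r}: representations S_a = {(1,a_1),…,(r,a_r)} of compositions (a_1,…,a_r)
of n of length r, i.e. graphs of functions from [r] to positive integers summing to n. -/
def compFam (n r : ℕ) : Finset (Finset (ℕ × ℕ)) :=
  (Finset.Icc 1 r ×ˢ Finset.Icc 1 n).powerset.filter
    (fun S => S.image Prod.fst = Finset.Icc 1 r ∧ S.card = r ∧ ∑ p ∈ S, p.2 = n)

/-- 𝖯_{n,r}: the family of partitions of [n] of length r, each partition viewed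
as the set of its parts. -/
def partFam (n r : ℕ) : Finset (Finset (Finset ℕ)) :=
  (Finset.Icc 1 n).powerset.powerset.filter
    (fun P => P.card = r ∧ (∀ X ∈ P, X ≠ ∅) ∧
      (∀ X ∈ P, ∀ Y ∈ P, X ≠ Y → X ∩ Y = ∅) ∧
      P.biUnion id = Finset.Icc 1 n)

/-- s_{n,r} = |𝖯_{n,r}|, the Stirling number of the second kind. -/
def stirling (n r : ℕ) : ℕ := (partFam n r).card
/-- Lemma 2.4: if every p of the k families have the cross-t-star property,
then all k of them do. -/
theorem stmt_4 {α : Type*} [DecidableEq α] {k p t : ℕ} (hp : 2 ≤ p) (hpk : p ≤ k)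
    (F : Fin k → Finset (Finset α))
    (h : ∀ e : Fin p → Fin k, Function.Injective e → CrossTStar t (fun j => F (e j))) :
    CrossTStar t F := by
  intro A hA hAF
  have : NeZero k := ⟨by omega⟩
  let e : Fin k → Fin p → Fin k := fun c j => c + Fin.castLE hpk j
  have he : ∀ c, Function.Injective (e c) := fun c =>
    (add_right_injective c).comp (Fin.castLE_injective hpk)
  have prod_shifts : ∀ f : Fin k → ℕ, ∏ c, ∏ j, f (e c j) = (∏ i, f i) ^ p := by
    intro f
    rw [Finset.prod_comm]
    calc ∏ j, ∏ c, f (e c j) = ∏ _j : Fin p, ∏ i, f i :=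
          Finset.prod_congr rfl fun j _ =>
            Fintype.prod_equiv (Equiv.addRight (Fin.castLE hpk j)) _ _ fun _ => rfl
      _ = (∏ i, f i) ^ p := by simp
  refine le_of_pow_le_pow_left₀ (n := p) (by omega) (Nat.zero_le _) ?_
  rw [← prod_shifts, ← prod_shifts]
  exact Finset.prod_le_prod' fun c _ => h (e c) (he c) (fun j => A (e c j))
    (fun i j hij => hA _ _ ((he c).ne hij)) fun j => hAF _
end

section
/- If T is a t-transversal of a subfamily 𝒜 of a family ℱ, then |𝒜| ≤ C(|T|,t)·l(ℱ,t), where C(|T|,t) is the binomial coefficient. -/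
open Finset

/-- The set over which `lstar` takes its supremum is bounded, so `lstar` bounds every star. -/
theorem card_famStar_le_lstar {α : Type*} [DecidableEq α] (F : Finset (Finset α))
    (S : Finset α) : (famStar F S).card ≤ lstar F S.card := by
  refine le_csSup ⟨F.card, ?_⟩ ⟨S, rfl, rfl⟩
  rintro _ ⟨S', -, rfl⟩
  exact card_filter_le _ _

/-- Lemma 3.1: if T is a t-transversal of 𝒜 ⊆ ℱ, then |𝒜| ≤ C(|T|,t)·l(ℱ,t). -/
theorem stmt_6 {α : Type*} [DecidableEq α] (t : ℕ)
    (F A : Finset (Finset α)) (hA : A ⊆ F)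
    (T : Finset α) (hT : ∀ a ∈ A, t ≤ (T ∩ a).card) :
    A.card ≤ Nat.choose T.card t * lstar F t := by
  have hcover : A ⊆ (T.powersetCard t).biUnion (famStar F) := by
    intro a ha
    obtain ⟨S, hS, hcard⟩ := exists_subset_card_eq (hT a ha)
    rw [subset_inter_iff] at hS
    exact mem_biUnion.2
      ⟨S, mem_powersetCard.2 ⟨hS.1, hcard⟩, mem_filter.2 ⟨hA ha, hS.2⟩⟩
  rw [← card_powersetCard]
  refine (card_le_card hcover).trans (card_biUnion_le_card_mul _ _ _ fun S hS => ?_)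
  obtain rfl := (mem_powersetCard.1 hS).2
  exact card_famStar_le_lstar F S
end

section
/- Let k ≥ 2 and 1 ≤ t ≤ r_1 ≤ … ≤ r_k, and for each i ∈ [k] let ℱ_i be the family of all r_i-element subsets of [n_i], where n_i ≥ (r_i − t)·c(r_{k−1},r_k,t) + t. Then (ℱ_1, …, ℱ_k) has the extrastrong cross-t-star property. -/
open Finset

section CrossIntersecting

variable {α : Type*} [DecidableEq α]

theorem famStar_mono {𝒜 F : Finset (Finset α)} (h : 𝒜 ⊆ F) (T : Finset α) :
    famStar 𝒜 T ⊆ famStar F T :=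
  Finset.filter_subset_filter _ h

/-- If every member of `𝒜` contains `T` and `t`-intersects a set `B` not containing the `t`-set
`T`, then every member of `𝒜` contains `T` and one further element of `B`. -/
theorem card_le_of_not_subset {𝒜 F : Finset (Finset α)} {B T : Finset α} {t f' : ℕ}
    (h𝒜 : 𝒜 ⊆ F) (hT : T.card = t) (hTB : ¬ T ⊆ B)
    (hT𝒜 : ∀ A ∈ 𝒜, T ⊆ A) (hB : ∀ A ∈ 𝒜, t ≤ (A ∩ B).card)
    (hF : ∀ U : Finset α, U.card = t + 1 → (famStar F U).card ≤ f') :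
    𝒜.card ≤ B.card * f' := by
  have hsub : 𝒜 ⊆ (B \ T).biUnion fun x => famStar F (insert x T) := by
    intro A hA
    obtain ⟨x, hx, hxT⟩ : ∃ x ∈ A ∩ B, x ∉ T := by
      by_contra! h
      have heq : A ∩ B = T := Finset.eq_of_subset_of_card_le h (by rw [hT]; exact hB A hA)
      exact hTB (heq ▸ Finset.inter_subset_right)
    rw [Finset.mem_inter] at hx
    refine Finset.mem_biUnion.2 ⟨x, Finset.mem_sdiff.2 ⟨hx.2, hxT⟩, Finset.mem_filter.2
      ⟨h𝒜 hA, Finset.insert_subset hx.1 (hT𝒜 A hA)⟩⟩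
  calc 𝒜.card ≤ _ := Finset.card_le_card hsub
    _ ≤ (B \ T).card * f' := Finset.card_biUnion_le_card_mul _ _ _ fun x hx => hF _ (by
        rw [Finset.card_insert_of_notMem (Finset.mem_sdiff.1 hx).2, hT])
    _ ≤ B.card * f' := Nat.mul_le_mul_right _ (Finset.card_le_card Finset.sdiff_subset)

/-- A family all of whose members `t`-intersect `B` is covered by its stars at the `t`-subsets
of `B`. -/
theorem card_le_choose_mul {𝒜 : Finset (Finset α)} {B : Finset α} {t m : ℕ}
    (hB : ∀ A ∈ 𝒜, t ≤ (A ∩ B).card)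
    (hm : ∀ T : Finset α, T.card = t → (famStar 𝒜 T).card ≤ m) :
    𝒜.card ≤ B.card.choose t * m := by
  have hsub : 𝒜 ⊆ (B.powersetCard t).biUnion fun T => famStar 𝒜 T := by
    intro A hA
    obtain ⟨T, hT, hTc⟩ := Finset.exists_subset_card_eq (hB A hA)
    rw [Finset.subset_inter_iff] at hT
    exact Finset.mem_biUnion.2 ⟨T, Finset.mem_powersetCard.2 ⟨hT.2, hTc⟩,
      Finset.mem_filter.2 ⟨hA, hT.1⟩⟩
  calc 𝒜.card ≤ _ := Finset.card_le_card hsub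
    _ ≤ (B.powersetCard t).card * m := Finset.card_biUnion_le_card_mul _ _ _ fun T hT =>
        hm T (Finset.mem_powersetCard.1 hT).2
    _ = B.card.choose t * m := by rw [Finset.card_powersetCard]

/-- If no `t`-set lies in all members of `𝒜`, then every star of a family `ℬ` that
cross-`t`-intersects `𝒜` is small, and so is `ℬ` itself. -/
theorem card_le_of_no_common {𝒜 ℬ G : Finset (Finset α)} {t r g' : ℕ}
    (hℬ : ℬ ⊆ G) (hr : ∀ A ∈ 𝒜, A.card = r) (hne : 𝒜.Nonempty)
    (hcross : ∀ B ∈ ℬ, ∀ A ∈ 𝒜, t ≤ (B ∩ A).card)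
    (hG : ∀ U : Finset α, U.card = t + 1 → (famStar G U).card ≤ g')
    (hno : ∀ T : Finset α, T.card = t → ∃ A ∈ 𝒜, ¬ T ⊆ A) :
    ℬ.card ≤ r.choose t * (r * g') := by
  obtain ⟨A₀, hA₀⟩ := hne
  have := card_le_choose_mul (B := A₀) (m := r * g') (fun B hB => hcross B hB A₀ hA₀) fun T hT => by
    obtain ⟨A, hA, hTA⟩ := hno T hT
    rw [← hr A hA]
    exact card_le_of_not_subset ((Finset.filter_subset _ _).trans hℬ) hT hTA
      (fun B hB => (Finset.mem_filter.1 hB).2)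
      (fun B hB => hcross B (Finset.mem_filter.1 hB).1 A hA) hG
  rwa [hr A₀ hA₀] at this

/-- One family has a common `t`-set which some member of the other family misses. -/
theorem card_mul_card_lt_of_common_left {𝒜 ℬ F G : Finset (Finset α)} {t r s f f' g : ℕ}
    (h𝒜 : 𝒜 ⊆ F) (hℬ : ℬ ⊆ G) (hr : ∀ A ∈ F, A.card = r) (hs : ∀ B ∈ G, B.card = s)
    (hne : 𝒜.Nonempty) (hcross : ∀ A ∈ 𝒜, ∀ B ∈ ℬ, t ≤ (A ∩ B).card)
    (hF : ∀ U : Finset α, U.card = t + 1 → (famStar F U).card ≤ f')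
    (hG : ∀ T : Finset α, T.card = t → (famStar G T).card ≤ g)
    (hf : s * r.choose t * f' < f) (hg : 0 < g)
    {T B₀ : Finset α} (hT : T.card = t) (hT𝒜 : ∀ A ∈ 𝒜, T ⊆ A) (hB₀ : B₀ ∈ ℬ)
    (hTB₀ : ¬ T ⊆ B₀) : 𝒜.card * ℬ.card < f * g := by
  obtain ⟨A₀, hA₀⟩ := hne
  have h1 := card_le_of_not_subset h𝒜 hT hTB₀ hT𝒜 (fun A hA => hcross A hA B₀ hB₀) hF
  have h2 := card_le_choose_mul (𝒜 := ℬ) (B := A₀) (m := g)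
    (fun B hB => by rw [Finset.inter_comm]; exact hcross A₀ hA₀ B hB)
    fun T hT => (Finset.card_le_card (famStar_mono hℬ T)).trans (hG T hT)
  rw [hs B₀ (hℬ hB₀)] at h1
  rw [hr A₀ (h𝒜 hA₀)] at h2
  calc 𝒜.card * ℬ.card ≤ (s * f') * (r.choose t * g) := Nat.mul_le_mul h1 h2
    _ = (s * r.choose t * f') * g := by ring
    _ < f * g := Nat.mul_lt_mul_of_pos_right hf hg

theorem card_mul_card_lt {𝒜 ℬ F G : Finset (Finset α)} {t r s f f' g g' : ℕ}
    (h𝒜 : 𝒜 ⊆ F) (hℬ : ℬ ⊆ G) (hr : ∀ A ∈ F, A.card = r) (hs : ∀ B ∈ G, B.card = s)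
    (hcross : ∀ A ∈ 𝒜, ∀ B ∈ ℬ, t ≤ (A ∩ B).card)
    (hFt : ∀ T : Finset α, T.card = t → (famStar F T).card ≤ f)
    (hGt : ∀ T : Finset α, T.card = t → (famStar G T).card ≤ g)
    (hF : ∀ U : Finset α, U.card = t + 1 → (famStar F U).card ≤ f')
    (hG : ∀ U : Finset α, U.card = t + 1 → (famStar G U).card ≤ g')
    (hf : s * r.choose t * f' < f) (hg : r * s.choose t * g' < g)
    (hno : ∀ T : Finset α, T.card = t → ¬ ((∀ A ∈ 𝒜, T ⊆ A) ∧ ∀ B ∈ ℬ, T ⊆ B)) :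
    𝒜.card * ℬ.card < f * g := by
  have hf0 : 0 < f := by omega
  have hg0 : 0 < g := by omega
  have hcross' : ∀ B ∈ ℬ, ∀ A ∈ 𝒜, t ≤ (B ∩ A).card := fun B hB A hA => by
    rw [Finset.inter_comm]; exact hcross A hA B hB
  rcases 𝒜.eq_empty_or_nonempty with rfl | h𝒜ne
  · simpa using ⟨hf0, hg0⟩
  rcases ℬ.eq_empty_or_nonempty with rfl | hℬne
  · simpa using ⟨hf0, hg0⟩
  by_cases hc : ∃ T : Finset α, T.card = t ∧ ∀ A ∈ 𝒜, T ⊆ A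
  · obtain ⟨T, hT, hT𝒜⟩ := hc
    obtain ⟨B₀, hB₀, hTB₀⟩ : ∃ B ∈ ℬ, ¬ T ⊆ B := by
      by_contra! h
      exact hno T hT ⟨hT𝒜, h⟩
    exact card_mul_card_lt_of_common_left h𝒜 hℬ hr hs h𝒜ne hcross hF hGt hf hg0 hT hT𝒜 hB₀ hTB₀
  by_cases hd : ∃ T : Finset α, T.card = t ∧ ∀ B ∈ ℬ, T ⊆ B
  · obtain ⟨T, hT, hTℬ⟩ := hd
    obtain ⟨A₀, hA₀, hTA₀⟩ : ∃ A ∈ 𝒜, ¬ T ⊆ A := by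
      by_contra! h
      exact hno T hT ⟨h, hTℬ⟩
    rw [mul_comm, mul_comm f]
    exact card_mul_card_lt_of_common_left hℬ h𝒜 hs hr hℬne hcross' hG hFt hg hf0 hT hTℬ hA₀ hTA₀
  push Not at hc hd
  have h1 := card_le_of_no_common hℬ (fun A hA => hr A (h𝒜 hA)) h𝒜ne hcross' hG hc
  have h2 := card_le_of_no_common h𝒜 (fun B hB => hs B (hℬ hB)) hℬne hcross hF hd
  calc 𝒜.card * ℬ.card ≤ (s.choose t * (s * f')) * (r.choose t * (r * g')) := Nat.mul_le_mul h2 h1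
    _ = (s * r.choose t * f') * (r * s.choose t * g') := by ring
    _ < f * g := Nat.mul_lt_mul'' hf hg

/-- The extrastrong cross-`t`-star property for two uniform families, in terms of bounds on the
sizes of their stars. -/
theorem card_mul_card_le_and_eq {𝒜 ℬ F G : Finset (Finset α)} {t r s f f' g g' : ℕ}
    (h𝒜 : 𝒜 ⊆ F) (hℬ : ℬ ⊆ G) (hr : ∀ A ∈ F, A.card = r) (hs : ∀ B ∈ G, B.card = s)
    (hcross : ∀ A ∈ 𝒜, ∀ B ∈ ℬ, t ≤ (A ∩ B).card)
    (hFt : ∀ T : Finset α, T.card = t → (famStar F T).card ≤ f)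
    (hGt : ∀ T : Finset α, T.card = t → (famStar G T).card ≤ g)
    (hF : ∀ U : Finset α, U.card = t + 1 → (famStar F U).card ≤ f')
    (hG : ∀ U : Finset α, U.card = t + 1 → (famStar G U).card ≤ g')
    (hf : s * r.choose t * f' < f) (hg : r * s.choose t * g' < g) :
    𝒜.card * ℬ.card ≤ f * g ∧ (𝒜.card * ℬ.card = f * g →
      ∃ T : Finset α, T.card = t ∧ 𝒜 = famStar F T ∧ ℬ = famStar G T ∧ ℬ.card = g) := by
  by_cases hno : ∃ T : Finset α, T.card = t ∧ (∀ A ∈ 𝒜, T ⊆ A) ∧ ∀ B ∈ ℬ, T ⊆ B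
  · obtain ⟨T, hT, hT𝒜, hTℬ⟩ := hno
    have h1 : 𝒜 ⊆ famStar F T := fun A hA => Finset.mem_filter.2 ⟨h𝒜 hA, hT𝒜 A hA⟩
    have h2 : ℬ ⊆ famStar G T := fun B hB => Finset.mem_filter.2 ⟨hℬ hB, hTℬ B hB⟩
    have h3 := (Finset.card_le_card h1).trans (hFt T hT)
    have h4 := (Finset.card_le_card h2).trans (hGt T hT)
    refine ⟨Nat.mul_le_mul h3 h4, fun heq => ?_⟩
    have h5 : f ≤ 𝒜.card := by
      by_contra! h
      exact (Nat.mul_lt_mul_of_lt_of_le h h4 (by omega)).ne heq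
    have h6 : g ≤ ℬ.card := by
      by_contra! h
      exact (Nat.mul_lt_mul_of_le_of_lt h3 h (by omega)).ne heq
    exact ⟨T, hT, Finset.eq_of_subset_of_card_le h1 ((hFt T hT).trans h5),
      Finset.eq_of_subset_of_card_le h2 ((hGt T hT).trans h6), le_antisymm h4 h6⟩
  · have := card_mul_card_lt h𝒜 hℬ hr hs hcross hFt hGt hF hG hf hg
      fun T hT h => hno ⟨T, hT, h⟩
    exact ⟨this.le, fun h => absurd h this.ne⟩

theorem eq_of_famStar_eq {F : Finset (Finset α)} {t f' : ℕ} {T T' : Finset α}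
    (hF : ∀ U : Finset α, U.card = t + 1 → (famStar F U).card ≤ f')
    (hT : T.card = t) (hT' : T'.card = t) (h : famStar F T = famStar F T')
    (hcard : f' < (famStar F T).card) : T = T' := by
  by_contra hne
  have hlt : t + 1 ≤ (T ∪ T').card := by
    by_contra! hlt
    have h1 := Finset.eq_of_subset_of_card_le (Finset.subset_union_left : T ⊆ T ∪ T') (by omega)
    have h2 := Finset.eq_of_subset_of_card_le (Finset.subset_union_right : T' ⊆ T ∪ T') (by omega)
    exact hne (h1.trans h2.symm)
  obtain ⟨U, hU, hUc⟩ := Finset.exists_subset_card_eq hlt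
  refine absurd (hF U hUc) (not_le.2 (hcard.trans_le (Finset.card_le_card fun A hA => ?_)))
  have hA' := hA
  rw [h] at hA'
  exact Finset.mem_filter.2 ⟨(Finset.mem_filter.1 hA).1,
    hU.trans (Finset.union_subset (Finset.mem_filter.1 hA).2 (Finset.mem_filter.1 hA').2)⟩

theorem card_famStar_powersetCard {S T : Finset α} {r : ℕ} (hTS : T ⊆ S) (hr : T.card ≤ r) :
    (famStar (S.powersetCard r) T).card = (S.card - T.card).choose (r - T.card) := by
  rw [← Finset.card_sdiff_of_subset hTS, ← Finset.card_powersetCard]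
  refine Finset.card_bij' (fun A _ => A \ T) (fun B _ => B ∪ T) ?_ ?_ ?_ ?_
  · intro A hA
    simp only [famStar, Finset.mem_filter, Finset.mem_powersetCard] at hA ⊢
    exact ⟨Finset.sdiff_subset_sdiff hA.1.1 le_rfl, by
      rw [Finset.card_sdiff_of_subset hA.2, hA.1.2]⟩
  · intro B hB
    simp only [famStar, Finset.mem_filter, Finset.mem_powersetCard] at hB ⊢
    refine ⟨⟨Finset.union_subset (hB.1.trans Finset.sdiff_subset) hTS, ?_⟩,
      Finset.subset_union_right⟩
    rw [Finset.card_union_of_disjoint (Finset.disjoint_of_subset_left hB.1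
      Finset.sdiff_disjoint), hB.2]
    omega
  · intro A hA
    exact Finset.sdiff_union_of_subset (Finset.mem_filter.1 hA).2
  · intro B hB
    exact Finset.union_sdiff_cancel_right (Finset.disjoint_of_subset_left
      (Finset.mem_powersetCard.1 hB).1 Finset.sdiff_disjoint)

theorem card_famStar_powersetCard_le {S T : Finset α} {r : ℕ} (hr : T.card ≤ r) :
    (famStar (S.powersetCard r) T).card ≤ (S.card - T.card).choose (r - T.card) := by
  by_cases hTS : T ⊆ S
  · exact (card_famStar_powersetCard hTS hr).le
  · rw [famStar, Finset.filter_false_of_mem]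
    · simp
    · exact fun A hA hTA => hTS (hTA.trans (Finset.mem_powersetCard.1 hA).1)

/-- Stars of `powersetCard r S` at `(t + 1)`-sets are smaller by a factor of `c` than those at
`t`-subsets of `S`. -/
theorem exists_famStar_powersetCard_bound {S : Finset α} {r t c : ℕ} (htr : t ≤ r) (hc : 0 < c)
    (hn : (r - t) * c + t ≤ S.card) :
    ∃ f' : ℕ, (∀ U : Finset α, U.card = t + 1 → (famStar (S.powersetCard r) U).card ≤ f') ∧
      ∀ m < c, m * f' < (S.card - t).choose (r - t) := by
  have hrS : r - t ≤ (r - t) * c := Nat.le_mul_of_pos_right _ hc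
  have hpos : 0 < (S.card - t).choose (r - t) := Nat.choose_pos (by omega)
  rcases htr.eq_or_lt with rfl | hlt
  · refine ⟨0, fun U hU => ?_, fun m _ => by simp⟩
    rw [famStar, Finset.filter_false_of_mem, Finset.card_empty]
    intro A hA hUA
    have := Finset.card_le_card hUA
    rw [(Finset.mem_powersetCard.1 hA).2] at this
    omega
  · obtain ⟨R, hR⟩ : ∃ R, r - t = R + 1 := ⟨r - t - 1, by omega⟩
    obtain ⟨N, hN⟩ : ∃ N, S.card - t = N + 1 := ⟨S.card - t - 1, by omega⟩
    refine ⟨N.choose R, fun U hU => ?_, fun m hm => ?_⟩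
    · have := card_famStar_powersetCard_le (S := S) (T := U) (r := r) (by omega)
      rwa [hU, show S.card - (t + 1) = N by omega, show r - (t + 1) = R by omega] at this
    · rw [hR, hN] at hpos ⊢
      have hcN : (R + 1) * c ≤ N + 1 := by rw [hR] at hn; omega
      have hle : c * N.choose R ≤ (N + 1).choose (R + 1) := by
        refine Nat.le_of_mul_le_mul_left ?_ R.succ_pos
        calc (R + 1) * (c * N.choose R) = ((R + 1) * c) * N.choose R := by ring
          _ ≤ (N + 1) * N.choose R := Nat.mul_le_mul_right _ hcN
          _ = (R + 1) * (N + 1).choose (R + 1) := by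
            rw [Nat.add_one_mul_choose_eq, mul_comm]
      rcases (N.choose R).eq_zero_or_pos with h0 | h0
      · simpa [h0] using hpos
      · exact (Nat.mul_lt_mul_of_pos_right hm h0).trans_le hle

end CrossIntersecting

theorem mul_choose_lt_cfun {a b r s t : ℕ} (hr : t ≤ r) (hs : t ≤ s)
    (h : (a ≤ r ∧ b ≤ s) ∨ (a ≤ s ∧ b ≤ r)) : a * b.choose t < cfun r s t := by
  rw [cfun, if_pos (le_min hr hs), Nat.lt_succ_iff]
  rcases h with ⟨ha, hb⟩ | ⟨ha, hb⟩
  · exact le_max_of_le_left (Nat.mul_le_mul ha (Nat.choose_le_choose t hb))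
  · exact le_max_of_le_right (Nat.mul_le_mul ha (Nat.choose_le_choose t hb))

/-- A product inequality follows from its two-factor versions along a permutation. -/
theorem prod_le_prod_of_perm {ι : Type*} [Fintype ι] (σ : Equiv.Perm ι) (a l : ι → ℕ)
    (hl : ∀ i, 0 < l i) (h : ∀ i, a i * a (σ i) ≤ l i * l (σ i)) :
    ∏ i, a i ≤ ∏ i, l i ∧
      (∏ i, a i = ∏ i, l i → ∀ i, a i * a (σ i) = l i * l (σ i)) := by
  have hsq : ∀ b : ι → ℕ, ∏ i, (b i * b (σ i)) = (∏ i, b i) ^ 2 := fun b => by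
    rw [Finset.prod_mul_distrib, Equiv.prod_comp σ b, sq]
  constructor
  · refine (Nat.pow_le_pow_iff_left two_ne_zero).1 ?_
    rw [← hsq, ← hsq]
    exact Finset.prod_le_prod' fun i _ => h i
  · intro heq i
    have hpos : ∀ i, 0 < a i := by
      have : ∏ i, a i ≠ 0 := by
        rw [heq]
        exact (Finset.prod_pos fun i _ => hl i).ne'
      exact fun i => Nat.pos_of_ne_zero (Finset.prod_ne_zero_iff.1 this i (Finset.mem_univ i))
    by_contra hne
    have hlt := Finset.prod_lt_prod (s := Finset.univ)
      (fun j _ => Nat.mul_pos (hpos j) (hpos (σ j))) (fun j _ => h j)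
      ⟨i, Finset.mem_univ i, (h i).lt_of_ne hne⟩
    rw [hsq, hsq, heq] at hlt
    exact lt_irrefl _ hlt

/-- Theorem 4.1 (levels of power sets). -/
theorem stmt_8 {k : ℕ} (hk : 2 ≤ k) (t : ℕ) (ht : 1 ≤ t)
    (r n : Fin k → ℕ) (hmono : Monotone r) (htr : t ≤ r ⟨0, by omega⟩)
    (hn : ∀ i, (r i - t) * cfun (r ⟨k - 2, by omega⟩) (r ⟨k - 1, by omega⟩) t + t ≤ n i) :
    ExtrastrongCrossTStar t
      (fun i => Finset.powersetCard (r i) (Finset.Icc 1 (n i))) := by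
  have htr' : ∀ i, t ≤ r i := fun i => htr.trans (hmono (Fin.mk_le_of_le_val (Nat.zero_le _)))
  set c := cfun (r ⟨k - 2, by omega⟩) (r ⟨k - 1, by omega⟩) t with hc
  have hcr : ∀ i j : Fin k, i ≠ j → r i * (r j).choose t < c := by
    intro i j hij
    refine mul_choose_lt_cfun (htr' _) (htr' _) ?_
    have hi := i.isLt
    have hj := j.isLt
    rcases lt_or_gt_of_ne hij with h | h
    · exact Or.inl ⟨hmono (Fin.mk_le_mk.2 (by omega)), hmono (Fin.mk_le_mk.2 (by omega))⟩
    · exact Or.inr ⟨hmono (Fin.mk_le_mk.2 (by omega)), hmono (Fin.mk_le_mk.2 (by omega))⟩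
  have hc1 : 1 < c := by
    have h1 := hcr ⟨0, by omega⟩ ⟨1, by omega⟩ (by simp)
    have h2 := Nat.mul_pos (ht.trans (htr' ⟨0, by omega⟩)) (Nat.choose_pos (htr' ⟨1, by omega⟩))
    omega
  have hS : ∀ i, (Finset.Icc 1 (n i)).card = n i := fun i => by simp
  choose f' hf' hm using fun i => exists_famStar_powersetCard_bound (S := Finset.Icc 1 (n i))
    (htr' i) (by omega : 0 < c) (by rw [hS]; exact hn i)
  simp only [hS] at hm
  set f : Fin k → ℕ := fun i => (n i - t).choose (r i - t) with hf
  have hfpos : ∀ i, 0 < f i := fun i => (Nat.zero_le _).trans_lt (hm i 1 hc1)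
  have hft : ∀ i, ∀ T : Finset ℕ, T.card = t →
      (famStar (Finset.powersetCard (r i) (Finset.Icc 1 (n i))) T).card ≤ f i := by
    intro i T hT
    have := card_famStar_powersetCard_le (S := Finset.Icc 1 (n i)) (T := T) (r := r i)
      (by rw [hT]; exact htr' i)
    rwa [hS, hT] at this
  refine ⟨Finset.Icc 1 t, by simp, fun A hA hAF => ?_⟩
  have hstar : ∀ i, (famStar (Finset.powersetCard (r i) (Finset.Icc 1 (n i)))
      (Finset.Icc 1 t)).card = f i := by
    intro i
    rw [card_famStar_powersetCard (Finset.Icc_subset_Icc_right (by have := hn i; omega))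
      (by simpa using htr' i)]
    simp [hf]
  simp only [hstar]
  obtain ⟨m, rfl⟩ : ∃ m, k = m + 2 := ⟨k - 2, by omega⟩
  have hne : ∀ i : Fin (m + 2), i ≠ i + 1 := fun i h => by simp at h
  have hpair := fun i : Fin (m + 2) => card_mul_card_le_and_eq (hAF i) (hAF (i + 1))
    (fun B hB => (Finset.mem_powersetCard.1 hB).2) (fun B hB => (Finset.mem_powersetCard.1 hB).2)
    (hA i (i + 1) (hne i)) (hft i) (hft (i + 1)) (hf' i) (hf' (i + 1))
    (hm i _ (hcr _ _ (hne i).symm)) (hm (i + 1) _ (hcr _ _ (hne i)))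
  obtain ⟨hle, heq⟩ := prod_le_prod_of_perm (Equiv.addRight (1 : Fin (m + 2)))
    (fun i => (A i).card) f hfpos (fun i => (hpair i).1)
  refine ⟨hle, fun h => ?_⟩
  choose T hT hAT hAT' hcard using fun i => (hpair i).2 (heq h i)
  have hstep : ∀ i, T (i + 1) = T i := by
    intro i
    refine eq_of_famStar_eq (hf' (i + 1)) (hT _) (hT _) ((hAT (i + 1)).symm.trans (hAT' i)) ?_
    rw [← hAT (i + 1), hcard i]
    simpa using hm (i + 1) 1 hc1
  have hconst : ∀ i, T i = T 0 := by
    intro i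
    induction i using Fin.induction with
    | zero => rfl
    | succ i ih => rw [← Fin.coeSucc_eq_succ, hstep, ih]
  exact ⟨T 0, hT 0, fun i => by rw [← hconst i]; exact hAT i⟩
end

section
/- If 1 < r < n, then s_{n,r} ≥ ((n−1)/(r−1))·s_{n−1,r−1}; equivalently, (r−1)·s_{n,r} ≥ (n−1)·s_{n−1,r−1}. -/
open Finset

theorem mem_partFam {n r : ℕ} {P : Finset (Finset ℕ)} :
    P ∈ partFam n r ↔ P.card = r ∧ ∅ ∉ P ∧
      (∀ X ∈ P, ∀ Y ∈ P, ∀ a, a ∈ X → a ∈ Y → X = Y) ∧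
      ∀ a, (∃ X ∈ P, a ∈ X) ↔ a ∈ Icc 1 n := by
  have hdisj : (∀ X ∈ P, ∀ Y ∈ P, X ≠ Y → X ∩ Y = ∅) ↔
      ∀ X ∈ P, ∀ Y ∈ P, ∀ a, a ∈ X → a ∈ Y → X = Y := by
    refine forall₄_congr fun X _ Y _ => ?_
    rw [← disjoint_iff_inter_eq_empty, Finset.disjoint_left]
    exact ⟨fun h a ha hb => by_contra fun hne => h hne ha hb,
      fun h hne a ha hb => hne (h a ha hb)⟩
  have hunion : P.biUnion id = Icc 1 n ↔ ∀ a, (∃ X ∈ P, a ∈ X) ↔ a ∈ Icc 1 n := by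
    simp [Finset.ext_iff]
  have hne : (∀ X ∈ P, X ≠ ∅) ↔ ∅ ∉ P :=
    ⟨fun h h0 => h ∅ h0 rfl, fun h X hX h0 => h (h0 ▸ hX)⟩
  rw [partFam, mem_filter, hdisj, hunion, hne, and_iff_right_iff_imp]
  rintro ⟨-, -, -, h⟩
  exact mem_powerset.2 fun X hX => mem_powerset.2 fun a ha => (h a).1 ⟨X, hX, ha⟩

theorem sum_card_of_mem_partFam {n r : ℕ} {P : Finset (Finset ℕ)} (hP : P ∈ partFam n r) :
    ∑ B ∈ P, B.card = n := by
  have h := (mem_filter.1 hP).2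
  have := card_biUnion (s := P) (t := id) fun X hX Y hY hne =>
    disjoint_iff_inter_eq_empty.2 (h.2.2.1 X hX Y hY hne)
  rw [h.2.2.2, Nat.card_Icc, Nat.add_sub_cancel] at this
  exact this.symm

/-- Isolate `x` from the rest of its part `B` and join it to the new element `n`, marking the
rest of `B`; if `B = {x}`, add the part `{n}` and mark `{x}` instead. -/
def isolate (n : ℕ) (q : (_ : Finset (Finset ℕ)) × (_ : Finset ℕ) × ℕ) :
    (_ : Finset (Finset ℕ)) × Finset ℕ :=
  if q.2.1 = {q.2.2} then ⟨insert {n} q.1, q.2.1⟩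
  else ⟨insert {q.2.2, n} (insert (q.2.1.erase q.2.2) (q.1.erase q.2.1)), q.2.1.erase q.2.2⟩

theorem notMem_of_mem_partFam {m k : ℕ} {P : Finset (Finset ℕ)} (hP : P ∈ partFam m k)
    {X : Finset ℕ} (hX : X ∈ P) : m + 1 ∉ X := fun h => by
  have := ((mem_partFam.1 hP).2.2.2 (m + 1)).1 ⟨X, hX, h⟩
  simp at this

theorem erase_notMem_of_mem_partFam {m k : ℕ} {P : Finset (Finset ℕ)} (hP : P ∈ partFam m k)
    {B : Finset ℕ} (hB : B ∈ P) {x : ℕ} (hx : x ∈ B) : B.erase x ∉ P := fun h => by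
  obtain ⟨-, h0, hd, -⟩ := mem_partFam.1 hP
  obtain ⟨a, ha⟩ := nonempty_iff_ne_empty.2 fun h' => h0 (h' ▸ h)
  have := hd _ h _ hB a ha (mem_of_mem_erase ha)
  exact (erase_eq_self.1 this) hx

theorem isolate_mem {m k : ℕ} {P : Finset (Finset ℕ)} (hP : P ∈ partFam m k)
    {B : Finset ℕ} (hB : B ∈ P) {x : ℕ} (hx : x ∈ B) :
    isolate (m + 1) ⟨P, B, x⟩ ∈
      (partFam (m + 1) (k + 1)).sigma fun P => P.filter (m + 1 ∉ ·) := by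
  obtain ⟨hc, h0, hd, hu⟩ := mem_partFam.1 hP
  have hn : ∀ X ∈ P, m + 1 ∉ X := fun X hX => notMem_of_mem_partFam hP hX
  have hu' : ∀ a, a ∈ Icc 1 (m + 1) ↔ a = m + 1 ∨ ∃ X ∈ P, a ∈ X := by
    intro a
    rw [hu, mem_Icc, mem_Icc]
    lia
  unfold isolate
  dsimp only
  split_ifs with hs
  · refine mem_sigma.2 ⟨mem_partFam.2 ⟨?_, ?_, ?_, ?_⟩, ?_⟩
    · rw [card_insert_of_notMem fun h => hn _ h (mem_singleton_self _), hc]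
    · grind
    · grind
    · intro a; rw [hu']; simp
    · simp [hB, hn B hB]
  · have hCP := erase_notMem_of_mem_partFam hP hB hx
    have hC0 : B.erase x ≠ ∅ := by grind
    have hxn : x ≠ m + 1 := fun h => hn B hB (h ▸ hx)
    have hD : {x, m + 1} ∉ insert (B.erase x) (P.erase B) := by
      intro h
      have hm : m + 1 ∈ ({x, m + 1} : Finset ℕ) := by simp
      rcases mem_insert.1 h with h | h
      · exact hn B hB (mem_of_mem_erase (h ▸ hm))
      · exact hn _ (mem_of_mem_erase h) hm
    refine mem_sigma.2 ⟨mem_partFam.2 ⟨?_, ?_, ?_, ?_⟩, ?_⟩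
    · rw [card_insert_of_notMem hD, card_insert_of_notMem fun h => hCP (mem_of_mem_erase h),
        card_erase_add_one hB, hc]
    · grind
    · have hBd : ∀ Y ∈ P.erase B, ∀ a ∈ Y, a ∉ B := fun Y hY a ha haB =>
        ne_of_mem_erase hY (hd _ (mem_of_mem_erase hY) _ hB a ha haB)
      intro X hX Y hY a haX haY
      simp only [mem_insert] at hX hY
      rcases hX with rfl | rfl | hX <;> rcases hY with rfl | rfl | hY <;> grind
    · intro a
      rw [hu']
      constructor
      · rintro ⟨X, hX, ha⟩
        grind
      · rintro (rfl | ⟨X, hX, ha⟩)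
        · exact ⟨_, mem_insert_self _ _, by simp⟩
        · by_cases hXB : X = B
          · by_cases hax : a = x
            · exact ⟨_, mem_insert_self _ _, by simp [hax]⟩
            · exact ⟨B.erase x, by simp, by grind⟩
          · exact ⟨X, by grind, ha⟩
    · have := hn B hB
      grind

theorem isolate_injOn (m k : ℕ) :
    Set.InjOn (isolate (m + 1)) ((partFam m k).sigma fun P => P.sigma id : Finset _) := by
  have hsing : ∀ {P : Finset (Finset ℕ)}, P ∈ partFam m k → {m + 1} ∉ P := fun hP h =>
    notMem_of_mem_partFam hP h (mem_singleton_self _)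
  have hmixed : ∀ {P Q : Finset (Finset ℕ)} {B : Finset ℕ} {x : ℕ}, P ∈ partFam m k → B ∈ P →
      x ∈ B → insert {m + 1} Q ≠ insert {x, m + 1} (insert (B.erase x) (P.erase B)) := by
    intro P Q B x hP hB hx h
    have hmem := h ▸ mem_insert_self {m + 1} Q
    have hn := notMem_of_mem_partFam hP hB
    simp only [mem_insert] at hmem
    rcases hmem with h | h | h
    · have : x ∈ ({m + 1} : Finset ℕ) := h ▸ mem_insert_self x _
      exact hn (mem_singleton.1 this ▸ hx)
    · exact hn (mem_of_mem_erase (h ▸ mem_singleton_self _))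
    · exact hsing hP (mem_of_mem_erase h)
  have hrecover : ∀ {P : Finset (Finset ℕ)} {B : Finset ℕ} {x : ℕ}, P ∈ partFam m k → B ∈ P →
      x ∈ B → P = insert B (((insert {x, m + 1}
        (insert (B.erase x) (P.erase B))).erase {x, m + 1}).erase (B.erase x)) := by
    intro P B x hP hB hx
    have hC := erase_notMem_of_mem_partFam hP hB hx
    have hD : {x, m + 1} ∉ P := fun h => notMem_of_mem_partFam hP h (by simp)
    ext X
    grind
  rintro ⟨P, B, x⟩ h ⟨Q, C, y⟩ h' heq
  simp only [mem_coe, mem_sigma, id] at h h'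
  obtain ⟨hP, hB, hx⟩ := h
  obtain ⟨hQ, hC, hy⟩ := h'
  unfold isolate at heq
  dsimp only at heq
  split_ifs at heq with hs hs' hs'
  · simp only [Sigma.mk.injEq, heq_eq_eq] at heq
    obtain ⟨hPQ, rfl⟩ := heq
    obtain rfl : x = y := singleton_injective (hs.symm.trans hs')
    rw [← erase_insert (hsing hP), hPQ, erase_insert (hsing hQ)]
  · exact absurd (congrArg Sigma.fst heq) (hmixed hQ hC hy)
  · exact absurd (congrArg Sigma.fst heq).symm (hmixed hP hB hx)
  · simp only [Sigma.mk.injEq, heq_eq_eq] at heq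
    obtain ⟨hPQ, hBC⟩ := heq
    obtain rfl : x = y := by
      have hmem := hPQ ▸ mem_insert_self {x, m + 1} _
      have hm : m + 1 ∈ ({x, m + 1} : Finset ℕ) := by simp
      have hxm : x ≠ m + 1 := fun h => notMem_of_mem_partFam hP hB (h ▸ hx)
      simp only [mem_insert] at hmem
      rcases hmem with h | h | h
      · have : x ∈ ({y, m + 1} : Finset ℕ) := h ▸ mem_insert_self _ _
        simpa [hxm] using this
      · exact absurd (mem_of_mem_erase (h ▸ hm)) (notMem_of_mem_partFam hQ hC)
      · exact absurd hm (notMem_of_mem_partFam hQ (mem_of_mem_erase h))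
    obtain rfl : B = C := by rw [← insert_erase hx, hBC, insert_erase hy]
    rw [hrecover hP hB hx, hPQ, ← hrecover hQ hC hy]

theorem mul_stirling_le (m k : ℕ) : m * stirling m k ≤ k * stirling (m + 1) (k + 1) := by
  have hmarked : ∀ P ∈ partFam (m + 1) (k + 1), (P.filter (m + 1 ∉ ·)).card ≤ k := by
    intro P hP
    obtain ⟨hc, -, -, hu⟩ := mem_partFam.1 hP
    obtain ⟨D, hD, hmD⟩ := (hu (m + 1)).2 (by simp)
    rw [← Nat.lt_succ_iff, Nat.succ_eq_add_one, ← hc]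
    exact card_lt_card (filter_ssubset.2 ⟨D, hD, not_not.2 hmD⟩)
  calc m * stirling m k = ((partFam m k).sigma fun P => P.sigma id).card := by
        simp only [card_sigma, id]
        rw [sum_congr rfl fun P hP => sum_card_of_mem_partFam hP, sum_const, smul_eq_mul,
          mul_comm, stirling]
    _ ≤ ((partFam (m + 1) (k + 1)).sigma fun P => P.filter (m + 1 ∉ ·)).card := by
        refine card_le_card_of_injOn (isolate (m + 1)) ?_ (isolate_injOn m k)
        rintro ⟨P, B, x⟩ h
        simp only [mem_coe, mem_sigma, id] at h
        exact isolate_mem h.1 h.2.1 h.2.2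
    _ ≤ k * stirling (m + 1) (k + 1) := by
        rw [card_sigma, stirling, mul_comm, ← smul_eq_mul]
        exact sum_le_card_nsmul _ _ _ hmarked

/-- Lemma 4.11: (r−1)·s_{n,r} ≥ (n−1)·s_{n−1,r−1}. -/
theorem stmt_16 (n r : ℕ) (h1 : 1 < r) (h2 : r < n) :
    (n - 1) * stirling (n - 1) (r - 1) ≤ (r - 1) * stirling n r := by
  have h := mul_stirling_le (n - 1) (r - 1)
  rwa [Nat.sub_add_cancel (by lia : 1 ≤ n), Nat.sub_add_cancel (by lia : 1 ≤ r)] at h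
end

section
/- If 1 ≤ t < r ≤ n, then l(𝖯_{n,r}, t) = s_{n−t, r−t}. -/
open Finset

/-- The family of partitions of the finite set `V` into exactly `k` parts. -/
def partsOn {α : Type*} [DecidableEq α] (V : Finset α) (k : ℕ) : Finset (Finset (Finset α)) :=
  V.powerset.powerset.filter
    (fun P => P.card = k ∧ (∀ X ∈ P, X ≠ ∅) ∧
      (∀ X ∈ P, ∀ Y ∈ P, X ≠ Y → X ∩ Y = ∅) ∧ P.biUnion id = V)

theorem mem_partsOn {α : Type*} [DecidableEq α] {V : Finset α} {k : ℕ}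
    {P : Finset (Finset α)} :
    P ∈ partsOn V k ↔ P.card = k ∧ (∀ X ∈ P, X ≠ ∅) ∧
      (∀ X ∈ P, ∀ Y ∈ P, X ≠ Y → X ∩ Y = ∅) ∧ P.biUnion id = V := by
  simp only [partsOn, mem_filter, mem_powerset, and_iff_right_iff_imp]
  rintro ⟨-, -, -, rfl⟩ X hX
  exact mem_powerset.2 (subset_biUnion_of_mem id hX)

theorem exists_image_eq_of_card_le {α β : Type*} [DecidableEq α] {V : Finset α} {W : Finset β}
    (hV : V.Nonempty) (h : V.card ≤ W.card) : ∃ g : β → α, W.image g = V := by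
  classical
  obtain ⟨a, ha⟩ := hV
  obtain ⟨f⟩ : Nonempty (V ↪ W) := Function.Embedding.nonempty_of_card_le (by simpa using h)
  have : Nonempty V := ⟨⟨a, ha⟩⟩
  refine ⟨fun b => if hb : b ∈ W then (Function.invFun f ⟨b, hb⟩).1 else a, ?_⟩
  ext x
  simp only [mem_image]
  constructor
  · rintro ⟨b, hb, rfl⟩
    simp [hb]
  · intro hx
    refine ⟨f ⟨x, hx⟩, (f ⟨x, hx⟩).2, ?_⟩
    simp [Function.leftInverse_invFun f.injective ⟨x, hx⟩]

/-- Pulling partitions back along a surjection `W → V` is injective. -/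
theorem card_partsOn_le_of_image_eq {α β : Type*} [DecidableEq α] [DecidableEq β]
    {V : Finset α} {W : Finset β} (g : β → α) (hg : W.image g = V) (k : ℕ) :
    (partsOn V k).card ≤ (partsOn W k).card := by
  let pull : Finset α → Finset β := fun X => W.filter (fun b => g b ∈ X)
  have image_pull : ∀ X, X ⊆ V → (pull X).image g = X := by
    intro X hX
    ext x
    simp only [pull, mem_image, mem_filter]
    constructor
    · rintro ⟨b, ⟨-, hb⟩, rfl⟩
      exact hb
    · intro hx
      obtain ⟨b, hb, rfl⟩ := mem_image.1 (hg ▸ hX hx)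
      exact ⟨b, ⟨hb, hx⟩, rfl⟩
  have sub : ∀ P ∈ partsOn V k, ∀ X ∈ P, X ⊆ V := by
    intro P hP X hX
    rw [← (mem_partsOn.1 hP).2.2.2]
    exact subset_biUnion_of_mem id hX
  have image_image_pull : ∀ P ∈ partsOn V k, (P.image pull).image (fun Y => Y.image g) = P := by
    intro P hP
    rw [image_image]
    conv_rhs => rw [← image_id (s := P)]
    exact image_congr fun X hX => image_pull X (sub P hP X hX)
  refine card_le_card_of_injOn (fun P => P.image pull) ?_ ?_
  · intro P hP
    obtain ⟨hk, hne, hdis, hun⟩ := mem_partsOn.1 (mem_coe.1 hP)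
    refine mem_coe.2 (mem_partsOn.2 ⟨?_, ?_, ?_, ?_⟩)
    · rw [card_image_of_injOn, hk]
      intro X hX Y hY hXY
      rw [← image_pull X (sub P hP X hX), ← image_pull Y (sub P hP Y hY)]
      exact congrArg _ hXY
    · simp only [mem_image, forall_exists_index, and_imp, forall_apply_eq_imp_iff₂]
      intro X hX h
      exact hne X hX (by rw [← image_pull X (sub P hP X hX), h, image_empty])
    · simp only [mem_image, forall_exists_index, and_imp, forall_apply_eq_imp_iff₂]
      intro X hX Y hY hXY
      have h := hdis X hX Y hY (fun h => hXY (by rw [h]))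
      rw [← filter_and]
      simp only [← mem_inter, h, notMem_empty, filter_false]
    · ext b
      have hb : b ∈ W → ∃ X ∈ P, g b ∈ X := by
        intro hb
        have := hg ▸ mem_image_of_mem g hb
        rw [← hun] at this
        simpa using this
      simp only [mem_biUnion, mem_image, id, exists_exists_and_eq_and, pull, mem_filter]
      exact ⟨fun ⟨_, _, h, _⟩ => h, fun h => (hb h).imp fun X hX => ⟨hX.1, h, hX.2⟩⟩
  · intro P hP Q hQ h
    rw [← image_image_pull P hP, ← image_image_pull Q hQ]
    exact congrArg _ h

theorem card_partsOn_mono {α β : Type*} [DecidableEq α] [DecidableEq β] {V : Finset α}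
    {W : Finset β} {k : ℕ} (hk : 0 < k) (h : V.card ≤ W.card) :
    (partsOn V k).card ≤ (partsOn W k).card := by
  rcases V.eq_empty_or_nonempty with rfl | hV
  · suffices partsOn (∅ : Finset α) k = ∅ by simp [this]
    refine eq_empty_of_forall_notMem fun P hP => ?_
    obtain ⟨rfl, hne, -, hun⟩ := mem_partsOn.1 hP
    obtain ⟨X, hX⟩ := card_pos.1 hk
    exact hne X hX (subset_empty.1 (hun ▸ subset_biUnion_of_mem id hX))
  · obtain ⟨g, hg⟩ := exists_image_eq_of_card_le hV h
    exact card_partsOn_le_of_image_eq g hg k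

theorem sdiff_mem_partsOn {α : Type*} [DecidableEq α] {V : Finset α} {k : ℕ}
    {P T : Finset (Finset α)} (hP : P ∈ partsOn V k) (hT : T ⊆ P) :
    P \ T ∈ partsOn (V \ T.biUnion id) (k - T.card) := by
  obtain ⟨rfl, hne, hdis, rfl⟩ := mem_partsOn.1 hP
  refine mem_partsOn.2 ⟨card_sdiff_of_subset hT, fun X hX => hne X (sdiff_subset hX),
    fun X hX Y hY => hdis X (sdiff_subset hX) Y (sdiff_subset hY), ?_⟩
  ext a
  simp only [mem_biUnion, mem_sdiff, id, not_exists, not_and]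
  constructor
  · rintro ⟨X, ⟨hX, hXT⟩, ha⟩
    refine ⟨⟨X, hX, ha⟩, fun Y hY haY => ?_⟩
    have := hdis X hX Y (hT hY) (fun h => hXT (h ▸ hY))
    exact notMem_empty a (this ▸ mem_inter.2 ⟨ha, haY⟩)
  · rintro ⟨⟨X, hX, ha⟩, h⟩
    exact ⟨X, ⟨hX, fun hXT => h X hXT ha⟩, ha⟩

theorem card_le_card_biUnion_of_subset_mem_partsOn {α : Type*} [DecidableEq α] {V : Finset α}
    {k : ℕ} {P T : Finset (Finset α)} (hP : P ∈ partsOn V k) (hT : T ⊆ P) :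
    T.card ≤ (T.biUnion id).card := by
  obtain ⟨-, hne, hdis, -⟩ := mem_partsOn.1 hP
  refine card_le_card_biUnion ?_ fun X hX => nonempty_iff_ne_empty.2 (hne X (hT hX))
  intro X hX Y hY hXY
  exact disjoint_iff_inter_eq_empty.2 (hdis X (hT hX) Y (hT hY) hXY)

theorem card_famStar_partsOn_le {α β : Type*} [DecidableEq α] [DecidableEq β] {V : Finset α}
    {W : Finset β} {k : ℕ} (T : Finset (Finset α)) (hT : T.card < k)
    (hW : V.card - T.card ≤ W.card) :
    (famStar (partsOn V k) T).card ≤ (partsOn W (k - T.card)).card := by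
  rcases (famStar (partsOn V k) T).eq_empty_or_nonempty with h | ⟨P, hP⟩
  · simp [h]
  · obtain ⟨hP, hTP⟩ := mem_filter.1 hP
    have hsub : T.biUnion id ⊆ V := by
      rw [← (mem_partsOn.1 hP).2.2.2]
      exact biUnion_subset_biUnion_of_subset_left _ hTP
    have hcard := card_le_card_biUnion_of_subset_mem_partsOn hP hTP
    calc (famStar (partsOn V k) T).card
        ≤ (partsOn (V \ T.biUnion id) (k - T.card)).card := by
          refine card_le_card_of_injOn (fun Q => Q \ T) ?_ ?_
          · intro Q hQ
            obtain ⟨hQ, hTQ⟩ := mem_filter.1 (mem_coe.1 hQ)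
            exact sdiff_mem_partsOn hQ hTQ
          · intro Q hQ R hR h
            have hQ := (mem_filter.1 (mem_coe.1 hQ)).2
            have hR := (mem_filter.1 (mem_coe.1 hR)).2
            rw [← sdiff_union_of_subset hQ, ← sdiff_union_of_subset hR]
            exact congrArg (· ∪ T) h
      _ ≤ _ := by
          refine card_partsOn_mono (by omega) ?_
          rw [card_sdiff_of_subset hsub]
          omega

/-- Adding the points of `U`, disjoint from `V`, as singleton parts. -/
theorem card_partsOn_le_card_famStar {α : Type*} [DecidableEq α] {U V : Finset α}
    (hUV : Disjoint V U) (k : ℕ) :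
    (partsOn V k).card ≤
      (famStar (partsOn (V ∪ U) (k + U.card)) (U.image singleton)).card := by
  have hdisj : ∀ P ∈ partsOn V k, Disjoint P (U.image singleton) := by
    intro P hP
    rw [disjoint_right]
    intro X hX hXP
    obtain ⟨u, hu, rfl⟩ := mem_image.1 hX
    refine disjoint_right.1 hUV hu ?_
    rw [← (mem_partsOn.1 hP).2.2.2]
    exact mem_biUnion.2 ⟨_, hXP, mem_singleton_self u⟩
  refine card_le_card_of_injOn (fun P => P ∪ U.image singleton) ?_ ?_
  · intro P hP
    have hd := hdisj P hP
    obtain ⟨rfl, hne, hdis, rfl⟩ := mem_partsOn.1 (mem_coe.1 hP)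
    refine mem_coe.2 (mem_filter.2 ⟨mem_partsOn.2 ⟨?_, ?_, ?_, ?_⟩, subset_union_right⟩)
    · rw [card_union_of_disjoint hd, card_image_of_injective _ singleton_injective]
    · intro X hX
      rcases mem_union.1 hX with hX | hX
      · exact hne X hX
      · obtain ⟨u, -, rfl⟩ := mem_image.1 hX
        exact singleton_ne_empty u
    · have mixed : ∀ X ∈ P, ∀ u ∈ U, X ∩ {u} = ∅ := by
        intro X hX u hu
        refine inter_singleton_of_notMem fun h => ?_
        exact disjoint_right.1 hUV hu (mem_biUnion.2 ⟨X, hX, h⟩)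
      intro X hX Y hY hXY
      rcases mem_union.1 hX with hX | hX <;> rcases mem_union.1 hY with hY | hY
      · exact hdis X hX Y hY hXY
      · obtain ⟨u, hu, rfl⟩ := mem_image.1 hY
        exact mixed X hX u hu
      · obtain ⟨u, hu, rfl⟩ := mem_image.1 hX
        rw [inter_comm]
        exact mixed Y hY u hu
      · obtain ⟨u, hu, rfl⟩ := mem_image.1 hX
        obtain ⟨v, hv, rfl⟩ := mem_image.1 hY
        exact inter_singleton_of_notMem fun h => hXY (by rw [mem_singleton.1 h])
    · rw [union_biUnion, image_biUnion]
      congr 1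
      exact biUnion_singleton_eq_self
  · intro P hP Q hQ h
    rw [← union_sdiff_cancel_right (hdisj P hP), ← union_sdiff_cancel_right (hdisj Q hQ)]
    exact congrArg (· \ U.image singleton) h

/-- Lemma 4.13: l(𝖯_{n,r},t) = s_{n−t,r−t}. -/
theorem stmt_17 (n r t : ℕ) (ht : 1 ≤ t) (htr : t < r) (hrn : r ≤ n) :
    lstar (partFam n r) t = stirling (n - t) (r - t) := by
  have upper : ∀ m ∈ {m : ℕ | ∃ T : Finset (Finset ℕ), T.card = t ∧
      m = (famStar (partFam n r) T).card}, m ≤ stirling (n - t) (r - t) := by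
    rintro m ⟨T, rfl, rfl⟩
    exact card_famStar_partsOn_le T htr (by simp)
  refine le_antisymm (csSup_le' upper) ?_
  have hunion : Finset.Icc 1 (n - t) ∪ Finset.Icc (n - t + 1) n = Finset.Icc 1 n := by
    ext a
    simp only [mem_union, Finset.mem_Icc]
    omega
  have hdisj : Disjoint (Finset.Icc 1 (n - t)) (Finset.Icc (n - t + 1) n) := by
    rw [Finset.disjoint_left]
    intro a
    simp only [Finset.mem_Icc]
    omega
  have hcard : (Finset.Icc (n - t + 1) n).card = t := by
    rw [Nat.card_Icc]
    omega
  have lower := card_partsOn_le_card_famStar hdisj (r - t)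
  rw [hunion, hcard, Nat.sub_add_cancel htr.le] at lower
  refine lower.trans (le_csSup ⟨_, upper⟩ ⟨_, ?_, rfl⟩)
  rw [card_image_of_injective _ singleton_injective, hcard]
end
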